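/- arXiv:2008.00494 — 8 statements merged into one kernel-verified Lean document; each statement's English description precedes it below -/
import Mathlib

section
/- Let J be a finite index set, let (M_j)_{j∈J} be a family of d_C × d_C complex matrices, and let Φ(Θ) = ∑_{j∈J} M_j * Θ * (M_j)ᴴ be the associated Kraus map on d_C × d_C matrices. Then Φ is block-preserving, i.e. P_X * Φ(Θ) * P_Y = Φ(P_X * Θ * P_Y) for every matrix Θ and every choice of X, Y ∈ {A, B}, if and only if every Kraus operator is block-diagonal, i.e. P_A * M_j * P_B = 0 and P_B * M_j * P_A = 0 for every j ∈ J. (Theorem 1 of the paper: a channel admits the Partially Coherent Direct Sum structure iff its Kraus operators have no off-diagonal blocks.) -/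
open Matrix

/-- Projector onto the A summand. -/
noncomputable def PA (dA dB : ℕ) : Matrix (Fin dA ⊕ Fin dB) (Fin dA ⊕ Fin dB) ℂ :=
  Matrix.fromBlocks 1 0 0 0

/-- Projector onto the B summand. -/
noncomputable def PB (dA dB : ℕ) : Matrix (Fin dA ⊕ Fin dB) (Fin dA ⊕ Fin dB) ℂ :=
  Matrix.fromBlocks 0 0 0 1

open scoped ComplexOrder in
/-- A finite sum of matrices `A j * (A j)ᴴ` vanishes only if every `A j` does. -/
theorem eq_zero_of_sum_mul_conjTranspose_self_eq_zero {J m n : Type*} [Fintype J] [Fintype m]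
    [Fintype n] {A : J → Matrix m n ℂ} (h : ∑ j, A j * (A j)ᴴ = 0) (j : J) : A j = 0 := by
  have ht : ∑ j, (A j * (A j)ᴴ).trace = 0 := by
    rw [← Matrix.trace_sum, h, Matrix.trace_zero]
  rw [Finset.sum_eq_zero_iff_of_nonneg fun j _ =>
    (Matrix.posSemidef_self_mul_conjTranspose (A j)).trace_nonneg] at ht
  exact Matrix.trace_mul_conjTranspose_self_eq_zero_iff.mp (ht j (Finset.mem_univ j))

/-- If compressing the image of a projector `Q` by a Hermitian `P` kills the Kraus map, then every
Kraus operator has vanishing `(P, Q)` block. -/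
theorem mul_kraus_mul_eq_zero {J n : Type*} [Fintype J] [Fintype n] {M : J → Matrix n n ℂ}
    {P Q : Matrix n n ℂ} (hP : Pᴴ = P) (hQ : Qᴴ = Q) (hQQ : Q * Q = Q)
    (h : P * (∑ j, M j * Q * (M j)ᴴ) * P = 0) (j : J) : P * M j * Q = 0 := by
  refine eq_zero_of_sum_mul_conjTranspose_self_eq_zero (A := fun j => P * M j * Q) ?_ j
  rw [← h, Finset.mul_sum, Finset.sum_mul]
  refine Finset.sum_congr rfl fun i _ => ?_
  rw [Matrix.conjTranspose_mul, Matrix.conjTranspose_mul, hP, hQ]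
  calc P * M i * Q * (Q * ((M i)ᴴ * P)) = P * M i * (Q * Q) * (M i)ᴴ * P := by
        simp only [Matrix.mul_assoc]
    _ = P * (M i * Q * (M i)ᴴ) * P := by rw [hQQ]; simp only [Matrix.mul_assoc]

/-- A Kraus map whose operators commute with the Hermitian matrices `P` and `Q` intertwines
the two-sided compression by `P` and `Q`. -/
theorem mul_sum_kraus_mul_of_commute {J n : Type*} [Fintype J] [Fintype n] {M : J → Matrix n n ℂ}
    {P Q : Matrix n n ℂ} (hQ : Qᴴ = Q) (hPM : ∀ j, P * M j = M j * P)
    (hQM : ∀ j, Q * M j = M j * Q) (Θ : Matrix n n ℂ) :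
    P * (∑ j, M j * Θ * (M j)ᴴ) * Q = ∑ j, M j * (P * Θ * Q) * (M j)ᴴ := by
  rw [Finset.mul_sum, Finset.sum_mul]
  refine Finset.sum_congr rfl fun i _ => ?_
  have hQM' : (M i)ᴴ * Q = Q * (M i)ᴴ := by
    simpa only [Matrix.conjTranspose_mul, hQ] using congrArg Matrix.conjTranspose (hQM i)
  calc P * (M i * Θ * (M i)ᴴ) * Q = P * M i * Θ * ((M i)ᴴ * Q) := by
        simp only [Matrix.mul_assoc]
    _ = M i * (P * Θ * Q) * (M i)ᴴ := by rw [hPM, hQM']; simp only [Matrix.mul_assoc]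

theorem mul_comm_of_off_diagonal_eq_zero {R : Type*} [Ring R] {P Q M : R} (hPQ : P + Q = 1)
    (h₁ : P * M * Q = 0) (h₂ : Q * M * P = 0) : P * M = M * P :=
  calc P * M = P * M * (P + Q) := by rw [hPQ, mul_one]
    _ = (P + Q) * M * P := by rw [mul_add, h₁, add_mul, add_mul, h₂]
    _ = M * P := by rw [hPQ, one_mul]

theorem PA_add_PB (dA dB : ℕ) : PA dA dB + PB dA dB = 1 := by
  simp [PA, PB, Matrix.fromBlocks_add]

theorem PA_mul_PB (dA dB : ℕ) : PA dA dB * PB dA dB = 0 := by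
  simp [PA, PB, Matrix.fromBlocks_multiply]

theorem PB_mul_PA (dA dB : ℕ) : PB dA dB * PA dA dB = 0 := by
  simp [PA, PB, Matrix.fromBlocks_multiply]

theorem PA_mul_self (dA dB : ℕ) : PA dA dB * PA dA dB = PA dA dB := by
  simp [PA, Matrix.fromBlocks_multiply]

theorem PB_mul_self (dA dB : ℕ) : PB dA dB * PB dA dB = PB dA dB := by
  simp [PB, Matrix.fromBlocks_multiply]

theorem conjTranspose_PA (dA dB : ℕ) : (PA dA dB)ᴴ = PA dA dB := by
  simp [PA, Matrix.fromBlocks_conjTranspose]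

theorem conjTranspose_PB (dA dB : ℕ) : (PB dA dB)ᴴ = PB dA dB := by
  simp [PB, Matrix.fromBlocks_conjTranspose]

/-- Theorem 1 of the paper: the Kraus map `Φ(Θ) = ∑ j, M j * Θ * (M j)ᴴ` is
block-preserving (PCDS) iff every Kraus operator is block-diagonal. -/
theorem pcds_iff_kraus_block_diagonal {dA dB : ℕ} (hA : 0 < dA) (hB : 0 < dB)
    {J : Type*} [Fintype J]
    (M : J → Matrix (Fin dA ⊕ Fin dB) (Fin dA ⊕ Fin dB) ℂ) :
    (∀ (Θ P Q : Matrix (Fin dA ⊕ Fin dB) (Fin dA ⊕ Fin dB) ℂ),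
        (P = PA dA dB ∨ P = PB dA dB) → (Q = PA dA dB ∨ Q = PB dA dB) →
        P * (∑ j, M j * Θ * (M j)ᴴ) * Q = ∑ j, M j * (P * Θ * Q) * (M j)ᴴ) ↔
      ∀ j, PA dA dB * M j * PB dA dB = 0 ∧ PB dA dB * M j * PA dA dB = 0 := by
  constructor
  · intro h j
    constructor
    · refine mul_kraus_mul_eq_zero (conjTranspose_PA dA dB) (conjTranspose_PB dA dB)
        (PB_mul_self dA dB) ?_ j
      rw [h _ _ _ (.inl rfl) (.inl rfl)]
      simp [PA_mul_PB]
    · refine mul_kraus_mul_eq_zero (conjTranspose_PB dA dB) (conjTranspose_PA dA dB)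
        (PA_mul_self dA dB) ?_ j
      rw [h _ _ _ (.inr rfl) (.inr rfl)]
      simp [PB_mul_PA]
  · intro h Θ P Q hP hQ
    have hcomm : ∀ P, (P = PA dA dB ∨ P = PB dA dB) → ∀ j, P * M j = M j * P := by
      rintro P (rfl | rfl) j
      · exact mul_comm_of_off_diagonal_eq_zero (PA_add_PB dA dB) (h j).1 (h j).2
      · exact mul_comm_of_off_diagonal_eq_zero ((add_comm _ _).trans (PA_add_PB dA dB))
          (h j).2 (h j).1
    have hQH : Qᴴ = Q := by
      rcases hQ with rfl | rfl
      · exact conjTranspose_PA dA dB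
      · exact conjTranspose_PB dA dB
    exact mul_sum_kraus_mul_of_commute hQH (hcomm P hP) (hcomm Q hQ) Θ
end

section
/- Let (M_j)_{j∈J} be a finite family of d_C × d_C complex matrices satisfying the trace-preservation condition ∑_{j∈J} (M_j)ᴴ * M_j = 1 and the block-diagonality condition P_A * M_j * P_B = 0 and P_B * M_j * P_A = 0 for all j. Then the diagonal blocks form a trace-preserving Kraus family on the A subspace: ∑_{j∈J} (P_A * M_j * P_A)ᴴ * (P_A * M_j * P_A) = P_A, and likewise ∑_{j∈J} (P_B * M_j * P_B)ᴴ * (P_B * M_j * P_B) = P_B. (The diagonal block terms of a PCDS channel are themselves proper CPT channels.) -/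
open Matrix

/-- If `Q = 1 - P` with `P` an orthogonal projector, and every member of a trace-preserving Kraus
family maps the range of `P` into itself, then the compressions to that range are
trace-preserving on it. -/
theorem sum_conjTranspose_mul_compression_eq {n J : Type*} [Fintype n] [DecidableEq n] [Fintype J]
    {P Q : Matrix n n ℂ} (hPQ : P + Q = 1) (hP : P * P = P) (hPH : Pᴴ = P)
    (M : J → Matrix n n ℂ) (htp : ∑ j, (M j)ᴴ * M j = 1) (hblock : ∀ j, Q * M j * P = 0) :
    ∑ j, (P * M j * P)ᴴ * (P * M j * P) = P := by
  have hM (j : J) : P * M j * P = M j * P := by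
    calc P * M j * P = (P + Q) * M j * P := by rw [add_mul, add_mul, hblock j, add_zero]
      _ = M j * P := by rw [hPQ, one_mul]
  calc ∑ j, (P * M j * P)ᴴ * (P * M j * P) = P * (∑ j, (M j)ᴴ * M j) * P := by
        simp only [hM, conjTranspose_mul, hPH, Finset.mul_sum, Finset.sum_mul, mul_assoc]
    _ = P := by rw [htp, mul_one, hP]

/-- The diagonal block terms of a PCDS channel are themselves proper CPT channels:
the diagonal blocks of a trace-preserving block-diagonal Kraus family are
trace-preserving Kraus families on each subspace. -/
theorem diagonal_blocks_trace_preserving {dA dB : ℕ} (hA : 0 < dA) (hB : 0 < dB)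
    {J : Type*} [Fintype J]
    (M : J → Matrix (Fin dA ⊕ Fin dB) (Fin dA ⊕ Fin dB) ℂ)
    (htp : ∑ j, (M j)ᴴ * M j = 1)
    (hblock : ∀ j, PA dA dB * M j * PB dA dB = 0 ∧ PB dA dB * M j * PA dA dB = 0) :
    (∑ j, (PA dA dB * M j * PA dA dB)ᴴ * (PA dA dB * M j * PA dA dB) = PA dA dB) ∧
      (∑ j, (PB dA dB * M j * PB dA dB)ᴴ * (PB dA dB * M j * PB dA dB) = PB dA dB) := by
  have hAB : PA dA dB + PB dA dB = 1 := by simp [PA, PB, fromBlocks_add]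
  exact ⟨sum_conjTranspose_mul_compression_eq hAB
      (by simp [PA, fromBlocks_multiply]) (by simp [PA, fromBlocks_conjTranspose])
      M htp fun j => (hblock j).2,
    sum_conjTranspose_mul_compression_eq ((add_comm _ _).trans hAB)
      (by simp [PB, fromBlocks_multiply]) (by simp [PB, fromBlocks_conjTranspose])
      M htp fun j => (hblock j).1⟩
end

section
/- Let (M_j)_{j∈J} be a finite family of d_C × d_C complex matrices with P_A * M_j * P_B = 0 and P_B * M_j * P_A = 0 for all j, and define the complementary map Φ̃ sending a d_C × d_C matrix ρ to the J × J matrix whose (j, j') entry is trace((M_{j'})ᴴ * M_j * ρ). Then for every ρ the complementary output depends only on the diagonal blocks of ρ and splits additively: Φ̃(ρ) = Φ̃(P_A * ρ * P_A) + Φ̃(P_B * ρ * P_B). (Equation (13) of the paper: the complementary channel of a PCDS channel is the sum of the complementary channels of its diagonal block components.) -/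
open Matrix

/-- The complementary map associated with a Kraus family. -/
noncomputable def complMap {J n : Type*} [Fintype n] (M : J → Matrix n n ℂ)
    (ρ : Matrix n n ℂ) : Matrix J J ℂ :=
  Matrix.of fun j j' => ((M j')ᴴ * M j * ρ).trace

/-- A matrix whose off-diagonal compressions vanish is block diagonal. -/
theorem eq_fromBlocks_of_compressions_eq_zero {dA dB : ℕ}
    {X : Matrix (Fin dA ⊕ Fin dB) (Fin dA ⊕ Fin dB) ℂ}
    (hAB : PA dA dB * X * PB dA dB = 0) (hBA : PB dA dB * X * PA dA dB = 0) :
    X = fromBlocks X.toBlocks₁₁ 0 0 X.toBlocks₂₂ := by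
  rw [← fromBlocks_toBlocks X, ← fromBlocks_zero] at hAB hBA
  simp only [PA, PB, fromBlocks_multiply, fromBlocks_inj] at hAB hBA
  conv_lhs => rw [← fromBlocks_toBlocks X]
  rw [fromBlocks_inj]
  simpa using And.intro hAB hBA

/-- Equation (13): the complementary channel of a PCDS channel depends only on
the diagonal blocks of the input and splits additively. -/
theorem complementary_splits {dA dB : ℕ} (hA : 0 < dA) (hB : 0 < dB)
    {J : Type*} [Fintype J]
    (M : J → Matrix (Fin dA ⊕ Fin dB) (Fin dA ⊕ Fin dB) ℂ)
    (hblock : ∀ j, PA dA dB * M j * PB dA dB = 0 ∧ PB dA dB * M j * PA dA dB = 0) :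
    ∀ ρ : Matrix (Fin dA ⊕ Fin dB) (Fin dA ⊕ Fin dB) ℂ,
      complMap M ρ =
        complMap M (PA dA dB * ρ * PA dA dB) + complMap M (PB dA dB * ρ * PB dA dB) := by
  intro ρ
  ext j j'
  rw [← fromBlocks_toBlocks ρ]
  simp only [complMap, of_apply, Matrix.add_apply]
  rw [eq_fromBlocks_of_compressions_eq_zero (hblock j).1 (hblock j).2,
    eq_fromBlocks_of_compressions_eq_zero (hblock j').1 (hblock j').2]
  simp [PA, PB, fromBlocks_conjTranspose, fromBlocks_multiply, trace]
end

section
/- Let (M_j)_{j∈J} be a finite Kraus family of d_C × d_C complex matrices with ∑_j (M_j)ᴴ M_j = 1 and P_A * M_j * P_B = 0 = P_B * M_j * P_A for all j; let Φ(Θ) = ∑_j M_j Θ (M_j)ᴴ and let Φ̃ be the complementary map. Suppose the A block is degradable, i.e. there is a finite family (L^A_k)_{k∈K_A} of J × d_C matrices with ∑_k (L^A_k)ᴴ L^A_k = P_A and Φ̃(Θ) = ∑_k L^A_k * Φ(Θ) * (L^A_k)ᴴ for every Θ with Θ = P_A Θ P_A, and suppose the analogous condition holds for the B block with a family (L^B_k)_{k∈K_B}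 satisfying ∑_k (L^B_k)ᴴ L^B_k = P_B. Then Φ is degradable: there exists a finite family (N_m) of J × d_C matrices with ∑_m (N_m)ᴴ N_m = 1 and Φ̃(ρ) = ∑_m N_m * Φ(ρ) * (N_m)ᴴ for every d_C × d_C matrix ρ. (One direction of Theorem 2: degradability of both diagonal blocks implies degradability of the PCDS channel, with degrading Kraus family given by the union {L^A_k} ∪ {L^B_k}.) -/
open Matrix

theorem PA_isHermitian (dA dB : ℕ) : (PA dA dB).IsHermitian := by
  simp [PA, Matrix.IsHermitian, Matrix.fromBlocks_conjTranspose]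

theorem PB_isHermitian (dA dB : ℕ) : (PB dA dB).IsHermitian := by
  simp [PB, Matrix.IsHermitian, Matrix.fromBlocks_conjTranspose]

theorem PA_isIdempotentElem (dA dB : ℕ) : IsIdempotentElem (PA dA dB) := by
  simp [PA, IsIdempotentElem, Matrix.fromBlocks_multiply]

theorem PB_isIdempotentElem (dA dB : ℕ) : IsIdempotentElem (PB dA dB) := by
  simp [PB, IsIdempotentElem, Matrix.fromBlocks_multiply]

open scoped ComplexOrder in
/-- A Kraus family that is trace-preserving on the range of a projector `P` is supported on `P`. -/
theorem kraus_mul_proj_eq_self {J K n : Type*} [Fintype J] [Fintype K] [Fintype n] [DecidableEq n]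
    {P : Matrix n n ℂ} (hP : P.IsHermitian) (hPP : IsIdempotentElem P)
    {L : K → Matrix J n ℂ} (hL : ∑ k, (L k)ᴴ * L k = P) (k : K) : L k * P = L k := by
  have hsum : ∑ i, (L i * (1 - P))ᴴ * (L i * (1 - P)) = 0 := by
    have hterm (i : K) : (L i * (1 - P))ᴴ * (L i * (1 - P)) =
        (1 - P) * ((L i)ᴴ * L i) * (1 - P) := by
      simp [Matrix.conjTranspose_mul, hP.eq, Matrix.mul_assoc]
    simp_rw [hterm]
    rw [← Finset.sum_mul, ← Finset.mul_sum, hL, hPP.one_sub_mul_self, zero_mul]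
  have htrace : ∑ i, ((L i * (1 - P))ᴴ * (L i * (1 - P))).trace = 0 := by
    rw [← Matrix.trace_sum, hsum, Matrix.trace_zero]
  have hk := (Finset.sum_eq_zero_iff_of_nonneg fun i _ =>
    (Matrix.posSemidef_conjTranspose_mul_self (L i * (1 - P))).trace_nonneg).1 htrace k
      (Finset.mem_univ k)
  rw [Matrix.trace_conjTranspose_mul_self_eq_zero_iff, Matrix.mul_sub, Matrix.mul_one,
    sub_eq_zero] at hk
  exact hk.symm

/-- A Kraus family supported on a projector `P` commuting with every `M j` only sees the
compression of the input to `P`. -/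
theorem sum_kraus_comp_eq_compression {J K n : Type*} [Fintype J] [Fintype K] [Fintype n]
    {P : Matrix n n ℂ} (hP : P.IsHermitian) {M : J → Matrix n n ℂ} (hM : ∀ j, Commute P (M j))
    {L : K → Matrix J n ℂ} (hL : ∀ k, L k * P = L k) (ρ : Matrix n n ℂ) :
    ∑ k, L k * (∑ j, M j * ρ * (M j)ᴴ) * (L k)ᴴ =
      ∑ k, L k * (∑ j, M j * (P * ρ * P) * (M j)ᴴ) * (L k)ᴴ := by
  have hM' (j : J) : P * (M j)ᴴ = (M j)ᴴ * P := by
    simpa [Matrix.conjTranspose_mul, hP.eq] using congrArg Matrix.conjTranspose (hM j).eq.symm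
  have hL' (k : K) : P * (L k)ᴴ = (L k)ᴴ := by
    simpa [Matrix.conjTranspose_mul, hP.eq] using congrArg Matrix.conjTranspose (hL k)
  refine Finset.sum_congr rfl fun k _ => ?_
  simp_rw [Matrix.mul_sum, Matrix.sum_mul]
  refine Finset.sum_congr rfl fun j _ => ?_
  calc L k * (M j * ρ * (M j)ᴴ) * (L k)ᴴ
      = (L k * P) * (M j * ρ * (M j)ᴴ) * (P * (L k)ᴴ) := by rw [hL, hL']
    _ = L k * ((P * M j) * ρ * ((M j)ᴴ * P)) * (L k)ᴴ := by simp only [Matrix.mul_assoc]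
    _ = L k * ((M j * P) * ρ * (P * (M j)ᴴ)) * (L k)ᴴ := by rw [(hM j).eq, hM']
    _ = L k * (M j * (P * ρ * P) * (M j)ᴴ) * (L k)ᴴ := by simp only [Matrix.mul_assoc]

/-- The complementary map of a Kraus family commuting with a projector `P` erases the
off-diagonal blocks of its input. -/
theorem complMap_eq_add_compressions {J n : Type*} [Fintype n] [DecidableEq n]
    {P Q : Matrix n n ℂ} (hPQ : P + Q = 1) (hP : P.IsHermitian) (hQ : Q.IsHermitian)
    (hPP : IsIdempotentElem P) (hQQ : IsIdempotentElem Q) {M : J → Matrix n n ℂ}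
    (hPM : ∀ j, Commute P (M j)) (hQM : ∀ j, Commute Q (M j)) (ρ : Matrix n n ℂ) :
    complMap M ρ = complMap M (P * ρ * P) + complMap M (Q * ρ * Q) := by
  have key {R : Matrix n n ℂ} (hR : R.IsHermitian) (hRR : IsIdempotentElem R)
      (hRM : ∀ j, Commute R (M j)) (i j : J) :
      ((M j)ᴴ * M i * (R * ρ * R)).trace = ((M j)ᴴ * M i * (R * ρ)).trace := by
    have hRM' : R * (M j)ᴴ = (M j)ᴴ * R := by
      simpa [Matrix.conjTranspose_mul, hR.eq] using congrArg Matrix.conjTranspose (hRM j).eq.symm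
    have hc : R * ((M j)ᴴ * M i) = (M j)ᴴ * M i * R := by
      rw [← Matrix.mul_assoc, hRM', Matrix.mul_assoc, (hRM i).eq, Matrix.mul_assoc]
    rw [← Matrix.mul_assoc, Matrix.trace_mul_comm, ← Matrix.mul_assoc, hc, Matrix.mul_assoc,
      ← Matrix.mul_assoc R, hRR.eq]
  ext i j
  simp only [complMap, Matrix.of_apply, Matrix.add_apply]
  rw [key hP hPP hPM, key hQ hQQ hQM, ← Matrix.trace_add, ← Matrix.mul_add, ← Matrix.add_mul,
    hPQ, Matrix.one_mul]

/-- A matrix without off-diagonal blocks commutes with the block projector. -/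
theorem commute_of_offDiag_eq_zero {n : Type*} [Fintype n] [DecidableEq n] {P Q X : Matrix n n ℂ}
    (hPQ : P + Q = 1) (h₁ : P * X * Q = 0) (h₂ : Q * X * P = 0) : Commute P X := by
  have e₁ : P * X = P * X * P := by
    simpa [← Matrix.mul_add, hPQ, h₁] using (Matrix.mul_add (P * X) P Q)
  have e₂ : X * P = P * X * P := by
    have h := Matrix.add_mul P Q (X * P)
    rw [hPQ, Matrix.one_mul, ← Matrix.mul_assoc, ← Matrix.mul_assoc, h₂, add_zero] at h
    exact h
  exact e₁.trans e₂.symm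

/-- One direction of Theorem 2: if both diagonal blocks of a PCDS channel are
degradable, then the PCDS channel itself is degradable. -/
theorem pcds_degradable_of_blocks_degradable {dA dB : ℕ} (hA : 0 < dA) (hB : 0 < dB)
    {J : Type*} [Fintype J]
    (M : J → Matrix (Fin dA ⊕ Fin dB) (Fin dA ⊕ Fin dB) ℂ)
    (htp : ∑ j, (M j)ᴴ * M j = 1)
    (hblock : ∀ j, PA dA dB * M j * PB dA dB = 0 ∧ PB dA dB * M j * PA dA dB = 0)
    {KA KB : Type*} [Fintype KA] [Fintype KB]
    (LA : KA → Matrix J (Fin dA ⊕ Fin dB) ℂ)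
    (hLA1 : ∑ k, (LA k)ᴴ * LA k = PA dA dB)
    (hLA2 : ∀ Θ : Matrix (Fin dA ⊕ Fin dB) (Fin dA ⊕ Fin dB) ℂ,
      Θ = PA dA dB * Θ * PA dA dB →
      complMap M Θ = ∑ k, LA k * (∑ j, M j * Θ * (M j)ᴴ) * (LA k)ᴴ)
    (LB : KB → Matrix J (Fin dA ⊕ Fin dB) ℂ)
    (hLB1 : ∑ k, (LB k)ᴴ * LB k = PB dA dB)
    (hLB2 : ∀ Θ : Matrix (Fin dA ⊕ Fin dB) (Fin dA ⊕ Fin dB) ℂ,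
      Θ = PB dA dB * Θ * PB dA dB →
      complMap M Θ = ∑ k, LB k * (∑ j, M j * Θ * (M j)ᴴ) * (LB k)ᴴ) :
    ∃ (m : ℕ) (N : Fin m → Matrix J (Fin dA ⊕ Fin dB) ℂ),
      ∑ k, (N k)ᴴ * N k = 1 ∧
      ∀ ρ : Matrix (Fin dA ⊕ Fin dB) (Fin dA ⊕ Fin dB) ℂ,
        complMap M ρ = ∑ k, N k * (∑ j, M j * ρ * (M j)ᴴ) * (N k)ᴴ := by
  have hsum := PA_add_PB dA dB
  have hAh := PA_isHermitian dA dB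
  have hBh := PB_isHermitian dA dB
  have hAi := PA_isIdempotentElem dA dB
  have hBi := PB_isIdempotentElem dA dB
  have hAM (j : J) : Commute (PA dA dB) (M j) :=
    commute_of_offDiag_eq_zero hsum (hblock j).1 (hblock j).2
  have hBM (j : J) : Commute (PB dA dB) (M j) :=
    commute_of_offDiag_eq_zero ((add_comm _ _).trans hsum) (hblock j).2 (hblock j).1
  have compress_eq {R : Matrix (Fin dA ⊕ Fin dB) (Fin dA ⊕ Fin dB) ℂ} (hR : IsIdempotentElem R)
      (ρ : Matrix (Fin dA ⊕ Fin dB) (Fin dA ⊕ Fin dB) ℂ) :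
      R * ρ * R = R * (R * ρ * R) * R := by
    rw [Matrix.mul_assoc R (R * ρ * R), Matrix.mul_assoc (R * ρ), hR.eq, ← Matrix.mul_assoc,
      ← Matrix.mul_assoc, hR.eq]
  let e := (Fintype.equivFin (KA ⊕ KB)).symm
  refine ⟨Fintype.card (KA ⊕ KB), fun k => Sum.elim LA LB (e k), ?_, fun ρ => ?_⟩
  · rw [e.sum_comp fun k => (Sum.elim LA LB k)ᴴ * Sum.elim LA LB k, Fintype.sum_sum_type]
    simp only [Sum.elim_inl, Sum.elim_inr]
    rw [hLA1, hLB1, hsum]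
  · rw [e.sum_comp fun k => Sum.elim LA LB k * (∑ j, M j * ρ * (M j)ᴴ) * (Sum.elim LA LB k)ᴴ,
      Fintype.sum_sum_type]
    simp only [Sum.elim_inl, Sum.elim_inr]
    rw [sum_kraus_comp_eq_compression hAh hAM (kraus_mul_proj_eq_self hAh hAi hLA1),
      sum_kraus_comp_eq_compression hBh hBM (kraus_mul_proj_eq_self hBh hBi hLB1),
      ← hLA2 _ (compress_eq hAi ρ), ← hLB2 _ (compress_eq hBi ρ)]
    exact complMap_eq_add_compressions hsum hAh hBh hAi hBi hAM hBM ρ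
end

section
/- Let (P_ℓ)_{ℓ ∈ Fin n} be a family of n' × n' complex matrices that are Hermitian idempotents, pairwise orthogonal (P_ℓ * P_{ℓ'} = 0 for ℓ ≠ ℓ') and complete (∑_ℓ P_ℓ = 1). Let (M_j)_{j∈J} be a finite family of n' × n' matrices and Φ(Θ) = ∑_j M_j Θ (M_j)ᴴ. Then Φ is multi-block-preserving, i.e. P_ℓ * Φ(Θ) * P_{ℓ'} = Φ(P_ℓ * Θ * P_{ℓ'}) for every matrix Θ and all ℓ, ℓ', if and only if P_ℓ * M_j * P_{ℓ'} = 0 for every j and every pair ℓ ≠ ℓ'. (Theorem 3 of the paper: the multi-block generalization of the PCDS Kraus characterization.) -/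
open Matrix

open scoped ComplexOrder in
/-- A finite family of complex matrices with `∑ j, A j * (A j)ᴴ = 0` vanishes identically. -/
theorem Matrix.eq_zero_of_sum_mul_conjTranspose_eq_zero {m k J : Type*} [Fintype m] [Fintype k]
    [Fintype J] {A : J → Matrix m k ℂ} (h : ∑ j, A j * (A j)ᴴ = 0) (j : J) : A j = 0 := by
  have htr : ∑ j, (A j * (A j)ᴴ).trace = 0 := by
    rw [← Matrix.trace_sum, h, Matrix.trace_zero]
  rw [Finset.sum_eq_zero_iff_of_nonneg
    fun j _ => (Matrix.posSemidef_self_mul_conjTranspose (A j)).trace_nonneg] at htr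
  exact Matrix.trace_mul_conjTranspose_self_eq_zero_iff.mp (htr j (Finset.mem_univ j))

/-- A matrix whose off-diagonal blocks with respect to a complete orthogonal family vanish
commutes with every member of the family. -/
theorem Matrix.commute_of_off_diagonal_blocks_eq_zero {m ι R : Type*} [Fintype m] [DecidableEq m]
    [Fintype ι] [Semiring R] {P : ι → Matrix m m R} (hcompl : ∑ i, P i = 1)
    {A : Matrix m m R} (h : ∀ i i', i ≠ i' → P i * A * P i' = 0) (i : ι) :
    Commute (P i) A := by
  have hl : P i * A = P i * A * P i := by
    rw [← Finset.sum_eq_single_of_mem (f := fun i' => P i * A * P i') i (Finset.mem_univ i)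
      fun i' _ hi => h i i' hi.symm, ← Finset.mul_sum, hcompl, mul_one]
  have hr : A * P i = P i * A * P i := by
    rw [← Finset.sum_eq_single_of_mem (f := fun i' => P i' * A * P i) i (Finset.mem_univ i)
      fun i' _ hi => h i' i hi, ← Finset.sum_mul, ← Finset.sum_mul, hcompl, one_mul]
  exact hl.trans hr.symm

/-- Theorem 3 of the paper: for a complete orthogonal family of projectors
`(P_ℓ)_{ℓ ∈ Fin n}`, the Kraus map `Φ(Θ) = ∑ j, M j * Θ * (M j)ᴴ` is
multi-block-preserving iff `P_ℓ * M_j * P_{ℓ'} = 0` for all `j` and all `ℓ ≠ ℓ'`. -/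
theorem multiblock_pcds_iff_kraus_block_diagonal {n' n : ℕ} (hn' : 1 ≤ n')
    (P : Fin n → Matrix (Fin n') (Fin n') ℂ)
    (hherm : ∀ ℓ, (P ℓ)ᴴ = P ℓ)
    (hidem : ∀ ℓ, P ℓ * P ℓ = P ℓ)
    (horth : ∀ ℓ ℓ', ℓ ≠ ℓ' → P ℓ * P ℓ' = 0)
    (hcompl : ∑ ℓ, P ℓ = 1)
    {J : Type*} [Fintype J]
    (M : J → Matrix (Fin n') (Fin n') ℂ) :
    (∀ (Θ : Matrix (Fin n') (Fin n') ℂ) (ℓ ℓ' : Fin n),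
        P ℓ * (∑ j, M j * Θ * (M j)ᴴ) * P ℓ' = ∑ j, M j * (P ℓ * Θ * P ℓ') * (M j)ᴴ) ↔
      ∀ (j : J) (ℓ ℓ' : Fin n), ℓ ≠ ℓ' → P ℓ * M j * P ℓ' = 0 := by
  constructor
  · intro h j ℓ ℓ' hne
    refine Matrix.eq_zero_of_sum_mul_conjTranspose_eq_zero (A := fun j => P ℓ * M j * P ℓ') ?_ j
    have key := h (P ℓ') ℓ ℓ
    rw [horth ℓ ℓ' hne] at key
    simp only [zero_mul, mul_zero, Finset.sum_const_zero] at key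
    rw [← key, Finset.mul_sum, Finset.sum_mul]
    refine Finset.sum_congr rfl fun j _ => ?_
    calc P ℓ * M j * P ℓ' * (P ℓ * M j * P ℓ')ᴴ
        = P ℓ * M j * (P ℓ' * P ℓ') * (M j)ᴴ * P ℓ := by
          simp only [Matrix.conjTranspose_mul, hherm, mul_assoc]
      _ = P ℓ * (M j * P ℓ' * (M j)ᴴ) * P ℓ := by
          simp only [hidem, mul_assoc]
  · intro h Θ ℓ ℓ'
    rw [Finset.mul_sum, Finset.sum_mul]
    refine Finset.sum_congr rfl fun j _ => ?_
    have hl : P ℓ * M j = M j * P ℓ :=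
      Matrix.commute_of_off_diagonal_blocks_eq_zero hcompl (h j) ℓ
    have hr : (M j)ᴴ * P ℓ' = P ℓ' * (M j)ᴴ := by
      simpa only [Matrix.conjTranspose_mul, hherm] using congrArg Matrix.conjTranspose
        (Matrix.commute_of_off_diagonal_blocks_eq_zero hcompl (h j) ℓ').eq
    calc P ℓ * (M j * Θ * (M j)ᴴ) * P ℓ'
        = P ℓ * M j * Θ * ((M j)ᴴ * P ℓ') := by simp only [mul_assoc]
      _ = M j * (P ℓ * Θ * P ℓ') * (M j)ᴴ := by rw [hl, hr]; simp only [mul_assoc]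
end

section
/- Let (P_ℓ)_{ℓ ∈ Fin n} be a complete orthogonal family of projectors on n' × n' complex matrices, and let (M_j)_{j∈J} be a finite Kraus family with ∑_j (M_j)ᴴ M_j = 1 and P_ℓ * M_j * P_{ℓ'} = 0 for all j and all ℓ ≠ ℓ'; let Φ(Θ) = ∑_j M_j Θ (M_j)ᴴ and let Φ̃ be the complementary map. Then Φ is degradable — i.e. there exists a finite family (N_m) of J × n' matrices with ∑_m (N_m)ᴴ N_m = 1 and Φ̃(ρ) = ∑_m N_m Φ(ρ) (N_m)ᴴ for all ρ — if and only if every diagonal block is degradable, i.e. for each ℓ there exists a finite family (L^ℓ_k) of J × n' matrices with ∑_k (L^ℓ_k)ᴴ L^ℓ_k = P_ℓ and Φ̃(Θ) = ∑_k L^ℓ_k Φ(Θ) (L^ℓ_k)ᴴ for every Θ with Θ = P_ℓ Θ P_ℓ. (Theorem 4 of the paper: a multi-block PCDS channel is degradable iff all its diagonal block channels are degradable.) -/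
open Matrix

/-- A matrix without off-diagonal blocks commutes with the block projectors. -/
theorem commute_of_offDiagonal_eq_zero {ι n : Type*} [Fintype ι] [Fintype n] [DecidableEq n]
    {P : ι → Matrix n n ℂ} (hcompl : ∑ ℓ, P ℓ = 1) {A : Matrix n n ℂ}
    (hA : ∀ ℓ ℓ', ℓ ≠ ℓ' → P ℓ * A * P ℓ' = 0) (ℓ : ι) : Commute (P ℓ) A := by
  have hl : P ℓ * A = P ℓ * A * P ℓ := by
    calc P ℓ * A = ∑ ℓ', P ℓ * A * P ℓ' := by rw [← Matrix.mul_sum, hcompl, mul_one]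
      _ = P ℓ * A * P ℓ := Fintype.sum_eq_single ℓ fun ℓ' h => hA ℓ ℓ' h.symm
  have hr : A * P ℓ = P ℓ * A * P ℓ := by
    calc A * P ℓ = ∑ ℓ', P ℓ' * A * P ℓ := by
          rw [← Matrix.sum_mul, ← Matrix.sum_mul, hcompl, one_mul]
      _ = P ℓ * A * P ℓ := Fintype.sum_eq_single ℓ fun ℓ' h => hA ℓ' ℓ h
  exact hl.trans hr.symm

/-- A Kraus map whose operators commute with a Hermitian matrix `Q` intertwines compression
by `Q`. -/
theorem sum_mul_compression_mul_conjTranspose {J n : Type*} [Fintype J] [Fintype n]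
    {M : J → Matrix n n ℂ} {Q : Matrix n n ℂ} (hQ : Qᴴ = Q) (hM : ∀ j, Commute Q (M j))
    (ρ : Matrix n n ℂ) :
    ∑ j, M j * (Q * ρ * Q) * (M j)ᴴ = Q * (∑ j, M j * ρ * (M j)ᴴ) * Q := by
  rw [Matrix.mul_sum, Matrix.sum_mul]
  refine Finset.sum_congr rfl fun j _ => ?_
  have h : Q * (M j)ᴴ = (M j)ᴴ * Q := by
    simpa [hQ] using (congrArg conjTranspose (hM j).eq).symm
  calc M j * (Q * ρ * Q) * (M j)ᴴ = (M j * Q) * ρ * (Q * (M j)ᴴ) := by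
        simp only [Matrix.mul_assoc]
    _ = Q * (M j * ρ * (M j)ᴴ) * Q := by
        rw [← (hM j).eq, h]; simp only [Matrix.mul_assoc]

/-- The complementary map of a block-diagonal Kraus family only sees the diagonal blocks. -/
theorem complMap_eq_sum_compression {ι J n : Type*} [Fintype ι] [Fintype n] [DecidableEq n]
    {P : ι → Matrix n n ℂ} (hherm : ∀ ℓ, (P ℓ)ᴴ = P ℓ) (hidem : ∀ ℓ, P ℓ * P ℓ = P ℓ)
    (hcompl : ∑ ℓ, P ℓ = 1) {M : J → Matrix n n ℂ} (hM : ∀ j ℓ, Commute (P ℓ) (M j))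
    (ρ : Matrix n n ℂ) : complMap M ρ = ∑ ℓ, complMap M (P ℓ * ρ * P ℓ) := by
  ext j j'
  have hblock : ∀ ℓ, ((M j')ᴴ * M j * (P ℓ * ρ * P ℓ)).trace
      = ((M j')ᴴ * M j * (P ℓ * ρ)).trace := fun ℓ => by
    have h : Commute (P ℓ) (M j')ᴴ := by
      simpa [Commute, SemiconjBy, hherm] using (congrArg conjTranspose (hM j' ℓ).eq).symm
    have hA : P ℓ * ((M j')ᴴ * M j) = (M j')ᴴ * M j * P ℓ := (h.mul_right (hM j ℓ)).eq
    rw [← Matrix.mul_assoc, Matrix.trace_mul_comm, ← Matrix.mul_assoc, hA, Matrix.mul_assoc,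
      ← Matrix.mul_assoc (P ℓ) (P ℓ) ρ, hidem]
  simp only [complMap, Matrix.sum_apply, Matrix.of_apply, hblock]
  rw [← Matrix.trace_sum, ← Matrix.mul_sum, ← Matrix.sum_mul, hcompl, one_mul]

/-- Theorem 4 of the paper: a multi-block PCDS channel is degradable iff all its
diagonal block channels are degradable. -/
theorem multiblock_degradable_iff {n' n : ℕ} (hn' : 1 ≤ n')
    (P : Fin n → Matrix (Fin n') (Fin n') ℂ)
    (hherm : ∀ ℓ, (P ℓ)ᴴ = P ℓ)
    (hidem : ∀ ℓ, P ℓ * P ℓ = P ℓ)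
    (horth : ∀ ℓ ℓ', ℓ ≠ ℓ' → P ℓ * P ℓ' = 0)
    (hcompl : ∑ ℓ, P ℓ = 1)
    {J : Type*} [Fintype J]
    (M : J → Matrix (Fin n') (Fin n') ℂ)
    (htp : ∑ j, (M j)ᴴ * M j = 1)
    (hblock : ∀ (j : J) (ℓ ℓ' : Fin n), ℓ ≠ ℓ' → P ℓ * M j * P ℓ' = 0) :
    (∃ (m : ℕ) (N : Fin m → Matrix J (Fin n') ℂ),
        ∑ k, (N k)ᴴ * N k = 1 ∧
        ∀ ρ : Matrix (Fin n') (Fin n') ℂ,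
          complMap M ρ = ∑ k, N k * (∑ j, M j * ρ * (M j)ᴴ) * (N k)ᴴ) ↔
      ∀ ℓ : Fin n, ∃ (m : ℕ) (L : Fin m → Matrix J (Fin n') ℂ),
        ∑ k, (L k)ᴴ * L k = P ℓ ∧
        ∀ Θ : Matrix (Fin n') (Fin n') ℂ, Θ = P ℓ * Θ * P ℓ →
          complMap M Θ = ∑ k, L k * (∑ j, M j * Θ * (M j)ᴴ) * (L k)ᴴ := by
  have hM : ∀ j ℓ, Commute (P ℓ) (M j) := fun j =>
    commute_of_offDiagonal_eq_zero hcompl (hblock j)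
  have hΦ : ∀ ℓ ρ, ∑ j, M j * (P ℓ * ρ * P ℓ) * (M j)ᴴ
      = P ℓ * (∑ j, M j * ρ * (M j)ᴴ) * P ℓ := fun ℓ =>
    sum_mul_compression_mul_conjTranspose (hherm ℓ) fun j => hM j ℓ
  have hgram : ∀ (ℓ : Fin n) (m : ℕ) (K : Fin m → Matrix J (Fin n') ℂ),
      ∑ k, (K k * P ℓ)ᴴ * (K k * P ℓ) = P ℓ * (∑ k, (K k)ᴴ * K k) * P ℓ := fun ℓ m K => by
    simp only [conjTranspose_mul, hherm, Matrix.mul_sum, Matrix.sum_mul, Matrix.mul_assoc]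
  have hconj : ∀ (ℓ : Fin n) (K : Matrix J (Fin n') ℂ) (X : Matrix (Fin n') (Fin n') ℂ),
      K * P ℓ * X * (K * P ℓ)ᴴ = K * (P ℓ * X * P ℓ) * Kᴴ := fun ℓ K X => by
    simp only [conjTranspose_mul, hherm, Matrix.mul_assoc]
  constructor
  · rintro ⟨m, N, hN, hdeg⟩ ℓ
    refine ⟨m, fun k => N k * P ℓ, ?_, fun Θ hΘ => ?_⟩
    · rw [hgram, hN, mul_one, hidem]
    · simp only [hconj, ← hΦ, ← hΘ]
      exact hdeg Θ
  · intro h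
    choose m L hL hdeg using h
    refine ⟨_, fun i => L (finSigmaFinEquiv.symm i).1 (finSigmaFinEquiv.symm i).2
      * P (finSigmaFinEquiv.symm i).1, ?_, fun ρ => ?_⟩
    · rw [finSigmaFinEquiv.symm.sum_comp
        fun x : (ℓ : Fin n) × Fin (m ℓ) => (L x.1 x.2 * P x.1)ᴴ * (L x.1 x.2 * P x.1),
        Fintype.sum_sigma]
      simp only [hgram, hL, hidem, hcompl]
    · rw [finSigmaFinEquiv.symm.sum_comp fun x : (ℓ : Fin n) × Fin (m ℓ) =>
          L x.1 x.2 * P x.1 * (∑ j, M j * ρ * (M j)ᴴ) * (L x.1 x.2 * P x.1)ᴴ,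
        Fintype.sum_sigma, complMap_eq_sum_compression hherm hidem hcompl hM]
      refine Finset.sum_congr rfl fun ℓ _ => ?_
      simp only [hconj, ← hΦ]
      refine hdeg ℓ _ ?_
      rw [← Matrix.mul_assoc, ← Matrix.mul_assoc, hidem, Matrix.mul_assoc _ (P ℓ) (P ℓ), hidem]
end

section
/- Let (M_j)_{j∈J} be a finite family of d_C × d_C complex matrices such that every Kraus operator is supported entirely on one of the two blocks: for each j, either M_j = P_A * M_j * P_A or M_j = P_B * M_j * P_B (the defining property of a Direct Sum channel, where any j with nonzero A block has vanishing B block and vice versa). Let Φ̃ be the complementary map. Then the complementary outputs of the two blocks have zero overlap: for all d_C × d_C matrices ρ and σ, Φ̃(P_A ρ P_A) * Φ̃(P_B σ P_B) = 0 and Φ̃(P_B σ P_B) * Φ̃(P_A ρ P_A) = 0. (For DS channels the sum Φ̃(ρ) = Φ̃(P_A ρ P_A) + Φ̃(P_B ρ P_B) is a genuine direct sum.) -/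
open Matrix

/-- A Kraus operator supported on `P` gives a zero row in the complementary output of a
matrix supported on an orthogonal `Q`. -/
theorem complMap_apply_eq_zero_of_left {J n : Type*} [Fintype n] {M : J → Matrix n n ℂ}
    {P Q : Matrix n n ℂ} (hPQ : P * Q = 0) {j : J} (hj : M j = P * M j * P)
    (σ : Matrix n n ℂ) (k : J) : complMap M (Q * σ * Q) j k = 0 := by
  have h : M j * Q = 0 := by rw [hj, Matrix.mul_assoc, hPQ, Matrix.mul_zero]
  have h' : (M k)ᴴ * M j * (Q * σ * Q) = (M k)ᴴ * (M j * Q) * σ * Q := by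
    simp only [Matrix.mul_assoc]
  simp [complMap, h', h]

/-- A Kraus operator supported on a Hermitian `P` gives a zero column in the complementary
output of a matrix supported on an orthogonal `Q`. -/
theorem complMap_apply_eq_zero_of_right {J n : Type*} [Fintype n] {M : J → Matrix n n ℂ}
    {P Q : Matrix n n ℂ} (hP : P.IsHermitian) (hQP : Q * P = 0) {k : J}
    (hk : M k = P * M k * P) (σ : Matrix n n ℂ) (j : J) :
    complMap M (Q * σ * Q) j k = 0 := by
  have h : Q * (M k)ᴴ = 0 := by
    rw [hk, conjTranspose_mul, hP.eq, ← Matrix.mul_assoc, hQP, Matrix.zero_mul]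
  have h' : Q * ((M k)ᴴ * M j * (Q * σ)) = Q * (M k)ᴴ * (M j * (Q * σ)) := by
    simp only [Matrix.mul_assoc]
  simp only [complMap, of_apply]
  rw [← Matrix.mul_assoc, trace_mul_comm, h', h, Matrix.zero_mul, trace_zero]

/-- If every Kraus operator is supported on one of two orthogonal Hermitian matrices, then the
complementary outputs of matrices supported on them multiply to zero. -/
theorem complMap_mul_complMap_eq_zero {J n : Type*} [Fintype J] [Fintype n]
    {M : J → Matrix n n ℂ} {P Q : Matrix n n ℂ} (hQ : Q.IsHermitian)
    (hPQ : P * Q = 0) (hM : ∀ j, M j = P * M j * P ∨ M j = Q * M j * Q)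
    (ρ σ : Matrix n n ℂ) :
    complMap M (P * ρ * P) * complMap M (Q * σ * Q) = 0 := by
  ext i k
  rw [Matrix.mul_apply, Matrix.zero_apply]
  refine Finset.sum_eq_zero fun j _ => ?_
  rcases hM j with hj | hj
  · rw [complMap_apply_eq_zero_of_left hPQ hj, mul_zero]
  · rw [complMap_apply_eq_zero_of_right hQ hPQ hj, zero_mul]

/-- For Direct Sum channels, whose Kraus operators are each supported entirely on
one block, the complementary outputs of the two blocks have zero overlap: the sum
`Φ̃(ρ) = Φ̃(P_A ρ P_A) + Φ̃(P_B ρ P_B)` is a genuine direct sum. -/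
theorem ds_complementary_zero_overlap {dA dB : ℕ} (hA : 0 < dA) (hB : 0 < dB)
    {J : Type*} [Fintype J]
    (M : J → Matrix (Fin dA ⊕ Fin dB) (Fin dA ⊕ Fin dB) ℂ)
    (hds : ∀ j, M j = PA dA dB * M j * PA dA dB ∨ M j = PB dA dB * M j * PB dA dB) :
    ∀ ρ σ : Matrix (Fin dA ⊕ Fin dB) (Fin dA ⊕ Fin dB) ℂ,
      complMap M (PA dA dB * ρ * PA dA dB) * complMap M (PB dA dB * σ * PB dA dB) = 0 ∧
      complMap M (PB dA dB * σ * PB dA dB) * complMap M (PA dA dB * ρ * PA dA dB) = 0 := by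
  intro ρ σ
  exact ⟨complMap_mul_complMap_eq_zero (PB_isHermitian dA dB) (PA_mul_PB dA dB) hds ρ σ,
    complMap_mul_complMap_eq_zero (PA_isHermitian dA dB) (PB_mul_PA dA dB)
      (fun j => (hds j).symm) σ ρ⟩
end

section
/- Let (P_ℓ)_{ℓ ∈ Fin n} be a complete orthogonal family of projectors on n' × n' complex matrices, and let (M_j)_{j∈J} be a finite family of n' × n' matrices with P_ℓ * M_j * P_{ℓ'} = 0 for all j and all ℓ ≠ ℓ'. Let Φ̃ be the complementary map sending ρ to the J × J matrix with (j, j') entry trace((M_{j'})ᴴ * M_j * ρ). Then for every ρ, Φ̃(ρ) = ∑_{ℓ ∈ Fin n} Φ̃(P_ℓ * ρ * P_ℓ), i.e. the complementary channel of a multi-block PCDS channel is the sum of the complementary channels of its diagonal block components. -/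
open Matrix

/-- An element that is block diagonal with respect to a family of elements summing to one
commutes with each member of the family. -/
theorem commute_of_sum_eq_one_of_offDiag_eq_zero {ι R : Type*} [Fintype ι] [Semiring R]
    {p : ι → R} (hp : ∑ i, p i = 1) {a : R}
    (ha : ∀ i j, i ≠ j → p i * a * p j = 0) (i : ι) : Commute (p i) a := by
  have hleft : p i * a = p i * a * p i := by
    rw [← Fintype.sum_eq_single i fun j hj => ha i j hj.symm, ← Finset.mul_sum, hp, mul_one]
  have hright : a * p i = p i * a * p i := by
    rw [← Fintype.sum_eq_single (f := fun j => p j * a * p i) i fun j hj => ha j i hj]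
    simp_rw [mul_assoc]
    rw [← Finset.sum_mul, hp, one_mul]
  exact hleft.trans hright.symm

/-- The complementary channel of a multi-block PCDS channel is the sum of the
complementary channels of its diagonal block components. -/
theorem multiblock_complementary_splits {n' n : ℕ}
    (P : Fin n → Matrix (Fin n') (Fin n') ℂ)
    (hherm : ∀ ℓ, (P ℓ)ᴴ = P ℓ)
    (hidem : ∀ ℓ, P ℓ * P ℓ = P ℓ)
    (horth : ∀ ℓ ℓ', ℓ ≠ ℓ' → P ℓ * P ℓ' = 0)
    (hcompl : ∑ ℓ, P ℓ = 1)
    {J : Type*} [Fintype J]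
    (M : J → Matrix (Fin n') (Fin n') ℂ)
    (hblock : ∀ (j : J) (ℓ ℓ' : Fin n), ℓ ≠ ℓ' → P ℓ * M j * P ℓ' = 0) :
    ∀ ρ : Matrix (Fin n') (Fin n') ℂ,
      complMap M ρ = ∑ ℓ, complMap M (P ℓ * ρ * P ℓ) := by
  intro ρ
  have hcomm (j : J) (ℓ : Fin n) : Commute (P ℓ) (M j) :=
    commute_of_sum_eq_one_of_offDiag_eq_zero hcompl (hblock j) ℓ
  have hcommH (j : J) (ℓ : Fin n) : Commute (P ℓ) (M j)ᴴ := by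
    have h : Commute (P ℓ)ᴴ (M j)ᴴ := (hcomm j ℓ).star_star
    rwa [hherm] at h
  ext j j'
  simp only [complMap, Matrix.sum_apply, Matrix.of_apply]
  have hterm (ℓ : Fin n) : ((M j')ᴴ * M j * (P ℓ * ρ * P ℓ)).trace =
      ((M j')ᴴ * M j * (P ℓ * ρ)).trace := by
    rw [← mul_assoc, Matrix.trace_mul_comm, ← mul_assoc,
      ((hcommH j' ℓ).mul_right (hcomm j ℓ)).eq, mul_assoc, ← mul_assoc (P ℓ), hidem]
  simp_rw [hterm]
  rw [← Matrix.trace_sum, ← Finset.mul_sum, ← Finset.sum_mul, hcompl, one_mul]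
end
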